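/- arXiv:math/0407260 — 2 statements merged into one kernel-verified Lean document; each statement's English description precedes it below -/
import Mathlib

section
/- For every positive integer n, all real numbers t_1, ..., t_n in (0, ∞), and all real numbers x, u with 0 ≤ x < u ≤ 1/2, the derivative of Φ_n satisfies Φ_n'(x) ≥ Φ_n'(u); that is, Φ_n' is nonincreasing on [0, 1/2]. -/
open MeasureTheory Real

/-- The one-dimensional Gaussian density `p_t(x) = (2πt)^{-1/2} exp(-x²/(2t))`. -/
noncomputable def gaussDensity (t x : ℝ) : ℝ :=
  (Real.sqrt (2 * Real.pi * t))⁻¹ * Real.exp (-x ^ 2 / (2 * t))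

/-- `Φ_n(x) = ∫_{-1}^{1} ⋯ ∫_{-1}^{1} ∏_{i=1}^{n} p_{t_i}(x_{i-1} - x_i) dx_1 ⋯ dx_n`,
with `x_0 = x`. -/
noncomputable def Phi (n : ℕ) (t : Fin n → ℝ) (x : ℝ) : ℝ :=
  ∫ y in Set.Icc (fun _ : Fin n => (-1 : ℝ)) (fun _ : Fin n => (1 : ℝ)),
    ∏ i : Fin n,
      gaussDensity (t i) ((Fin.cons x y : Fin (n + 1) → ℝ) i.castSucc - (Fin.cons x y : Fin (n + 1) → ℝ) i.succ)

/-- An even nonnegative `C¹` function `f` whose derivative satisfies `f' z ≤ f' x` whenever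
`x ≤ z` have their midpoint in `[0, 1/2]`. -/
structure MidConcave (f : ℝ → ℝ) : Prop where
  contDiff : ContDiff ℝ 1 f
  even : ∀ x, f (-x) = f x
  nonneg : ∀ x, 0 ≤ f x
  deriv_le : ∀ x z, x ≤ z → 0 ≤ x + z → x + z ≤ 1 → deriv f z ≤ deriv f x

/-- A `C¹` nonnegative kernel which is a nonincreasing function of `|x|`. -/
structure UnimodalKernel (p : ℝ → ℝ) : Prop where
  contDiff : ContDiff ℝ 1 p
  nonneg : ∀ x, 0 ≤ p x
  antitone : ∀ x y, |x| ≤ |y| → p y ≤ p x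

namespace UnimodalKernel

variable {p f : ℝ → ℝ}

theorem even (hp : UnimodalKernel p) (x : ℝ) : p (-x) = p x :=
  le_antisymm (hp.antitone _ _ (by simp)) (hp.antitone _ _ (by simp))

theorem hasDerivAt (hp : UnimodalKernel p) (x : ℝ) : HasDerivAt p (deriv p x) x :=
  (hp.contDiff.differentiable one_ne_zero x).hasDerivAt

theorem continuous_deriv (hp : UnimodalKernel p) : Continuous (deriv p) :=
  hp.contDiff.continuous_deriv le_rfl

theorem hasDerivAt_integral (hp : UnimodalKernel p) (hf : Continuous f) (x : ℝ) :
    HasDerivAt (fun x => ∫ y in (-1 : ℝ)..1, p (x - y) * f y)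
      (∫ y in (-1 : ℝ)..1, deriv p (x - y) * f y) x := by
  have hc := hp.contDiff.continuous
  have hd := hp.continuous_deriv
  obtain ⟨C, hC⟩ := ((isCompact_Icc (a := x - 1) (b := x + 1)).prod
    (isCompact_Icc (a := (-1 : ℝ)) (b := 1))).exists_bound_of_continuousOn
    (f := fun q : ℝ × ℝ => deriv p (q.1 - q.2) * f q.2) (by fun_prop)
  refine (intervalIntegral.hasDerivAt_integral_of_dominated_loc_of_deriv_le
    (F' := fun x y => deriv p (x - y) * f y) (bound := fun _ => C)
    (Icc_mem_nhds (a := x - 1) (b := x + 1) (by linarith) (by linarith))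
    (.of_forall fun x => ?_) ?_ ?_ (.of_forall fun y hy z hz => ?_) (by simp)
    (.of_forall fun y _ z _ => ?_)).2
  · exact Continuous.aestronglyMeasurable (by fun_prop)
  · exact Continuous.intervalIntegrable (by fun_prop) _ _
  · exact Continuous.aestronglyMeasurable (by fun_prop)
  · rw [Set.uIoc_of_le (by norm_num)] at hy
    exact hC (z, y) ⟨hz, hy.1.le, hy.2⟩
  · simpa using (((hp.hasDerivAt (z - y)).comp z ((hasDerivAt_id z).sub_const y)).mul_const (f y))

theorem deriv_integral (hp : UnimodalKernel p) (hf : MidConcave f) (x : ℝ) :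
    deriv (fun x => ∫ y in (-1 : ℝ)..1, p (x - y) * f y) x =
      (∫ y in (-1 : ℝ)..1, p (x - y) * deriv f y) - f 1 * (p (x - 1) - p (x + 1)) := by
  have hc := hp.contDiff.continuous
  have hd := hp.continuous_deriv
  have hfd := hf.contDiff.continuous_deriv le_rfl
  have hparts := intervalIntegral.integral_mul_deriv_eq_deriv_mul (a := (-1 : ℝ)) (b := 1)
    (u := fun y => p (x - y)) (u' := fun y => -deriv p (x - y)) (v := f) (v' := deriv f)
    (fun y _ => by
      simpa [Function.comp_def] using
        (hp.hasDerivAt (x - y)).comp y ((hasDerivAt_id y).const_sub x))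
    (fun y _ => (hf.contDiff.differentiable one_ne_zero y).hasDerivAt)
    (Continuous.intervalIntegrable (by fun_prop) _ _) (hfd.intervalIntegrable _ _)
  rw [(hp.hasDerivAt_integral hf.contDiff.continuous x).deriv, hparts]
  simp only [neg_mul, intervalIntegral.integral_neg, hf.even, sub_neg_eq_add]
  ring

theorem sub_nonneg_of_le (hp : UnimodalKernel p) {x y z : ℝ} (hxz : x ≤ z) (h : x + z ≤ 2 * y) :
    0 ≤ p (z - y) - p (x - y) := by
  refine sub_nonneg.2 (hp.antitone _ _ (sq_le_sq.1 ?_))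
  nlinarith

theorem sub_nonpos_of_le (hp : UnimodalKernel p) {x y z : ℝ} (hxz : x ≤ z) (h : 2 * y ≤ x + z) :
    p (z - y) - p (x - y) ≤ 0 := by
  refine sub_nonpos.2 (hp.antitone _ _ (sq_le_sq.1 ?_))
  nlinarith

/-- Reflecting the interval of integration about the midpoint of `x` and `z` turns the integrand
into a product of two factors of opposite sign. -/
theorem integral_sub_mul_deriv_nonpos (hp : UnimodalKernel p) (hf : MidConcave f) {x z : ℝ}
    (hxz : x ≤ z) (h0 : 0 ≤ x + z) (h1 : x + z ≤ 1) :
    ∫ y in (-1 : ℝ)..1, (p (z - y) - p (x - y)) * deriv f y ≤ 0 := by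
  have hc := hp.contDiff.continuous
  have hfd := hf.contDiff.continuous_deriv le_rfl
  have hodd (y : ℝ) : deriv f (-y) = -deriv f y := by
    have h := deriv_comp_neg f y
    simp only [hf.even] at h
    linarith
  have hint (a b : ℝ) : IntervalIntegrable (fun y => (p (z - y) - p (x - y)) * deriv f y)
      volume a b := Continuous.intervalIntegrable (by fun_prop) _ _
  rw [← intervalIntegral.integral_add_adjacent_intervals (hint (-1) (x + z - 1))
    (hint (x + z - 1) 1)]
  have integral_nonpos {a b : ℝ} {g : ℝ → ℝ} (hab : a ≤ b) (hg : ∀ y ∈ Set.Icc a b, g y ≤ 0) :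
      ∫ y in a..b, g y ≤ 0 := by
    have h := intervalIntegral.integral_nonneg (μ := volume) (f := fun y => -g y) hab
      fun y hy => neg_nonneg.2 (hg y hy)
    rw [intervalIntegral.integral_neg] at h
    linarith
  have hleft : ∫ y in (-1 : ℝ)..(x + z - 1), (p (z - y) - p (x - y)) * deriv f y ≤ 0 := by
    refine integral_nonpos (by linarith) fun y hy => mul_nonpos_of_nonpos_of_nonneg
      (hp.sub_nonpos_of_le hxz (by linarith [hy.2])) ?_
    have h := hf.deriv_le y (-y) (by linarith [hy.2]) (by linarith) (by linarith)
    linarith [hodd y]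
  have hrefl : ∫ y in (x + z - 1)..1, (p (z - y) - p (x - y)) * deriv f y =
      -∫ y in (x + z - 1)..1, (p (z - y) - p (x - y)) * deriv f (x + z - y) := by
    have h := intervalIntegral.integral_comp_sub_left (a := x + z - 1) (b := 1)
      (fun y => (p (z - y) - p (x - y)) * deriv f y) (x + z)
    rw [show x + z - (x + z - 1) = 1 by ring] at h
    rw [← h, ← intervalIntegral.integral_neg]
    refine intervalIntegral.integral_congr fun y _ => ?_
    rw [← hp.even (z - (x + z - y)), ← hp.even (x - (x + z - y))]
    ring_nf
  have hright : ∫ y in (x + z - 1)..1,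
      (p (z - y) - p (x - y)) * (deriv f y - deriv f (x + z - y)) ≤ 0 := by
    refine integral_nonpos (by linarith) fun y _ => ?_
    rcases le_total (x + z) (2 * y) with hy | hy
    · exact mul_nonpos_of_nonneg_of_nonpos (hp.sub_nonneg_of_le hxz hy) (sub_nonpos.2
        (hf.deriv_le _ _ (by linarith) (by linarith) (by linarith)))
    · exact mul_nonpos_of_nonpos_of_nonneg (hp.sub_nonpos_of_le hxz hy) (sub_nonneg.2
        (hf.deriv_le _ _ (by linarith) (by linarith) (by linarith)))
  simp only [mul_sub] at hright
  rw [intervalIntegral.integral_sub (hint _ _)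
    (Continuous.intervalIntegrable (by fun_prop) _ _)] at hright
  linarith

theorem midConcave_integral (hp : UnimodalKernel p) (hf : MidConcave f) :
    MidConcave fun x => ∫ y in (-1 : ℝ)..1, p (x - y) * f y where
  contDiff := by
    have hc := hp.continuous_deriv
    have hfc := hf.contDiff.continuous
    have hd := hp.hasDerivAt_integral hfc
    refine contDiff_one_iff_deriv.2 ⟨fun x => (hd x).differentiableAt, ?_⟩
    rw [funext fun x => (hd x).deriv]
    exact intervalIntegral.continuous_parametric_intervalIntegral_of_continuous'
      (by fun_prop) _ _
  even x := by
    have h := intervalIntegral.integral_comp_neg (a := -1) (b := 1)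
      (fun y => p (-x - y) * f y)
    rw [neg_neg] at h
    rw [← h]
    refine intervalIntegral.integral_congr fun y _ => ?_
    simp only [hf.even]
    rw [← hp.even]
    ring_nf
  nonneg x := intervalIntegral.integral_nonneg (by norm_num) fun y _ =>
    mul_nonneg (hp.nonneg _) (hf.nonneg _)
  deriv_le x z hxz h0 h1 := by
    have hc := hp.contDiff.continuous
    have hfd := hf.contDiff.continuous_deriv le_rfl
    rw [hp.deriv_integral hf, hp.deriv_integral hf]
    have h := hp.integral_sub_mul_deriv_nonpos hf hxz h0 h1
    simp only [sub_mul] at h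
    rw [intervalIntegral.integral_sub (Continuous.intervalIntegrable (by fun_prop) _ _)
      (Continuous.intervalIntegrable (by fun_prop) _ _)] at h
    have hone := mul_nonneg (hf.nonneg 1)
      (hp.sub_nonneg_of_le (y := 1) hxz (by linarith))
    have hneg := mul_nonneg (hf.nonneg 1) (neg_nonneg.2
      (hp.sub_nonpos_of_le (y := -1) hxz (by linarith)))
    simp only [sub_neg_eq_add] at hneg
    linarith

end UnimodalKernel

theorem unimodalKernel_gaussDensity {t : ℝ} (ht : 0 < t) : UnimodalKernel (gaussDensity t) where
  contDiff := by
    unfold gaussDensity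
    fun_prop
  nonneg x := by
    unfold gaussDensity
    positivity
  antitone x y h := by
    unfold gaussDensity
    have := sq_le_sq.2 h
    gcongr

theorem Phi_zero (t : Fin 0 → ℝ) : Phi 0 t = fun _ => 1 := by
  ext x
  simp [Phi, measureReal_def, Real.volume_Icc_pi]

theorem Phi_succ (n : ℕ) (t : Fin (n + 1) → ℝ) (ht : ∀ i, 0 < t i) (x : ℝ) :
    Phi (n + 1) t x =
      ∫ y in (-1 : ℝ)..1, gaussDensity (t 0) (x - y) * Phi n (Fin.tail t) y := by
  let e := MeasurableEquiv.piFinSuccAbove (fun _ : Fin (n + 1) => ℝ) 0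
  have hem : MeasurePreserving e.symm :=
    (volume_preserving_piFinSuccAbove (fun _ : Fin (n + 1) => ℝ) 0).symm _
  have hpre : e.symm ⁻¹' Set.Icc (fun _ => -1) (fun _ => 1) =
      Set.Icc (-1 : ℝ) 1 ×ˢ Set.Icc (fun _ : Fin n => (-1 : ℝ)) fun _ => 1 :=
    ((Fin.insertNthOrderIso (fun _ => ℝ) 0).preimage_Icc _ _).trans (Set.Icc_prod_eq _ _)
  have hcont (i : Fin (n + 1)) : Continuous (gaussDensity (t i)) :=
    (unimodalKernel_gaussDensity (ht i)).contDiff.continuous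
  have hsymm (q : ℝ × (Fin n → ℝ)) : e.symm q = Fin.cons q.1 q.2 := by
    simp [e, MeasurableEquiv.piFinSuccAbove, Fin.consEquiv]
  rw [Phi, ← hem.map_eq, setIntegral_map_equiv, hpre, Measure.volume_eq_prod, setIntegral_prod]
  · rw [intervalIntegral.integral_of_le (by norm_num), ← integral_Icc_eq_integral_Ioc]
    refine integral_congr_ae (.of_forall fun y => ?_)
    simp only [Phi, hsymm, Fin.prod_univ_succ, Fin.castSucc_zero, Fin.cons_zero, Fin.cons_succ,
      ← Fin.succ_castSucc, Fin.tail]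
    rw [integral_const_mul]
  · refine ContinuousOn.integrableOn_compact (isCompact_Icc.prod isCompact_Icc) ?_
    refine Continuous.continuousOn (continuous_finsetProd _ fun i _ => (hcont i).comp ?_)
    simp only [hsymm]
    fun_prop

theorem midConcave_Phi (n : ℕ) (t : Fin n → ℝ) (ht : ∀ i, 0 < t i) : MidConcave (Phi n t) := by
  induction n with
  | zero =>
    rw [Phi_zero]
    exact ⟨contDiff_const, fun _ => rfl, fun _ => zero_le_one, fun _ _ _ _ _ => by simp⟩
  | succ n ih =>
    rw [funext (Phi_succ n t ht)]
    exact (unimodalKernel_gaussDensity (ht 0)).midConcave_integral (ih _ fun i => ht i.succ)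

/-- `Φ_n'` is nonincreasing on `[0, 1/2]`: for `0 ≤ x < u ≤ 1/2`,
`Φ_n'(x) ≥ Φ_n'(u)`. -/
theorem phi_deriv_antitone (n : ℕ) (hn : 0 < n) (t : Fin n → ℝ) (ht : ∀ i, 0 < t i)
    (x u : ℝ) (hx0 : 0 ≤ x) (hxu : x < u) (hu : u ≤ 1 / 2) :
    deriv (Phi n t) u ≤ deriv (Phi n t) x := by
  exact (midConcave_Phi n t ht).deriv_le x u hxu.le (by linarith) (by linarith)
end

section
/- Let a > 0 and let 0 < t_1 < t_2 < ⋯ < t_n. Define F : ℝ → ℝ by F(x) = ∫_{-a}^{a} ⋯ ∫_{-a}^{a} ∏_{i=1}^{n} p_{t_i - t_{i-1}}(x_{i-1} - x_i) dx_1 ⋯ dx_n, where x_0 = x and t_0 = 0. Then F is concave on the interval (-a/2, a/2); moreover F'(x) ≥ 0 for x ∈ (-a, 0) and F'(x) ≤ 0 for x ∈ (0, a). (This function F(x) equals P_x{B_{t_1} ∈ (-a,a), ..., B_{t_n} ∈ (-a,a)} for one-dimensional Brownian motion B_t started at x.) -/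
open MeasureTheory Real

/-- `F(x) = ∫_{-a}^{a} ⋯ ∫_{-a}^{a} ∏_{i=1}^{n} p_{t_i - t_{i-1}}(x_{i-1} - x_i) dx_1 ⋯ dx_n`,
with `x_0 = x` and `t_0 = 0`.  This equals `P_x{B_{t_1} ∈ (-a,a), ..., B_{t_n} ∈ (-a,a)}`
for one-dimensional Brownian motion started at `x`. -/
noncomputable def brownianFDD (n : ℕ) (a : ℝ) (t : Fin n → ℝ) (x : ℝ) : ℝ :=
  ∫ y in Set.Icc (fun _ : Fin n => -a) (fun _ : Fin n => a),
    ∏ i : Fin n,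
      gaussDensity
        ((Fin.cons 0 t : Fin (n + 1) → ℝ) i.succ - (Fin.cons 0 t : Fin (n + 1) → ℝ) i.castSucc)
        ((Fin.cons x y : Fin (n + 1) → ℝ) i.castSucc - (Fin.cons x y : Fin (n + 1) → ℝ) i.succ)

lemma gaussDensity_le_of_abs_le {s x y : ℝ} (hs : 0 < s) (h : |x| ≤ |y|) :
    gaussDensity s y ≤ gaussDensity s x := by
  have h2 : x ^ 2 ≤ y ^ 2 := sq_le_sq.2 h
  unfold gaussDensity
  gcongr

lemma even_of_le_of_abs_le {p : ℝ → ℝ} (hp : ∀ y z, |y| ≤ |z| → p z ≤ p y) (y : ℝ) :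
    p (-y) = p y :=
  le_antisymm (hp _ _ (by simp)) (hp _ _ (by simp))

lemma contDiff_gaussDensity (s : ℝ) : ContDiff ℝ 1 (gaussDensity s) := by
  unfold gaussDensity
  fun_prop

/-- A `C¹` function `g` with `g' = -v` that is even, nonnegative at `a`, and whose slope `v`
satisfies `v y ≤ v z` whenever `0 ≤ y ≤ z` and `y + z ≤ a`. -/
structure MidConcaveProfile (a : ℝ) (g v : ℝ → ℝ) : Prop where
  hasDerivAt : ∀ x, HasDerivAt g (-v x) x
  continuous_slope : Continuous v
  slope_neg : ∀ x, v (-x) = -v x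
  map_neg : ∀ x, g (-x) = g x
  nonneg_end : 0 ≤ g a
  slope_le : ∀ y z, 0 ≤ y → y ≤ z → y + z ≤ a → v y ≤ v z

namespace MidConcaveProfile

variable {a : ℝ} {g v : ℝ → ℝ}

lemma slope_zero (h : MidConcaveProfile a g v) : v 0 = 0 := by
  have := h.slope_neg 0
  rw [neg_zero] at this
  linarith

lemma slope_nonneg (h : MidConcaveProfile a g v) {x : ℝ} (hx : 0 ≤ x) (hxa : x ≤ a) :
    0 ≤ v x := by
  simpa [h.slope_zero] using h.slope_le 0 x le_rfl hx (by simpa using hxa)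

lemma continuous (h : MidConcaveProfile a g v) : Continuous g :=
  continuous_iff_continuousAt.2 fun x => (h.hasDerivAt x).continuousAt

lemma nonneg (h : MidConcaveProfile a g v) {x : ℝ} (hx : 0 ≤ x) (hxa : x ≤ a) : 0 ≤ g x := by
  have hanti : AntitoneOn g (Set.Icc 0 a) := by
    refine antitoneOn_of_deriv_nonpos (convex_Icc 0 a) h.continuous.continuousOn
      (fun y _ => (h.hasDerivAt y).differentiableAt.differentiableWithinAt) fun y hy => ?_
    rw [interior_Icc] at hy
    rw [(h.hasDerivAt y).deriv]
    exact neg_nonpos.2 (h.slope_nonneg hy.1.le hy.2.le)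
  exact h.nonneg_end.trans (hanti ⟨hx, hxa⟩ ⟨hx.trans hxa, le_rfl⟩ hxa)

lemma slope_monotoneOn (h : MidConcaveProfile a g v) :
    MonotoneOn v (Set.Ioo (-(a / 2)) (a / 2)) := by
  rintro x ⟨hx1, hx2⟩ y ⟨hy1, hy2⟩ hxy
  rcases le_total 0 x with hx | hx
  · exact h.slope_le x y hx hxy (by linarith)
  rcases le_total 0 y with hy | hy
  · have h1 := h.slope_nonneg (x := -x) (by linarith) (by linarith)
    have h2 := h.slope_nonneg hy (by linarith)
    rw [h.slope_neg] at h1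
    linarith
  · have h1 := h.slope_le (-y) (-x) (by linarith) (by linarith) (by linarith)
    rw [h.slope_neg, h.slope_neg] at h1
    linarith

lemma concaveOn (h : MidConcaveProfile a g v) : ConcaveOn ℝ (Set.Ioo (-(a / 2)) (a / 2)) g := by
  refine AntitoneOn.concaveOn_of_deriv (convex_Ioo _ _) h.continuous.continuousOn
    (fun y _ => (h.hasDerivAt y).differentiableAt.differentiableWithinAt) ?_
  rw [interior_Ioo]
  intro x hx y hy hxy
  rw [(h.hasDerivAt x).deriv, (h.hasDerivAt y).deriv]
  exact neg_le_neg (h.slope_monotoneOn hx hy hxy)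

/-- The slope of `x ↦ ∫ y in -a..a, p (x - y) * g y`, after integration by parts. -/
noncomputable def convSlope (p : ℝ → ℝ) (a : ℝ) (g v : ℝ → ℝ) (x : ℝ) : ℝ :=
  (∫ y in -a..a, p (x - y) * v y) + g a * (p (x - a) - p (x + a))

lemma hasDerivAt_conv {p : ℝ → ℝ} (hp : ContDiff ℝ 1 p) (hg : Continuous g) (x : ℝ) :
    HasDerivAt (fun x => ∫ y in -a..a, p (x - y) * g y)
      (∫ y in -a..a, deriv p (x - y) * g y) x := by
  have hp' : Continuous (deriv p) := hp.continuous_deriv le_rfl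
  have hpc : Continuous p := hp.continuous
  obtain ⟨C, hC⟩ := (isCompact_Icc (a := x - 1 - |a|) (b := x + 1 + |a|)
    ).exists_bound_of_continuousOn hp'.continuousOn
  refine (intervalIntegral.hasDerivAt_integral_of_dominated_loc_of_deriv_le
    (F := fun x y => p (x - y) * g y) (F' := fun x y => deriv p (x - y) * g y)
    (bound := fun y => C * ‖g y‖)
    (Metric.closedBall_mem_nhds x one_pos) ?_ ?_ ?_ ?_ ?_ ?_).2
  · exact .of_forall fun z => Continuous.aestronglyMeasurable (by fun_prop)
  · exact Continuous.intervalIntegrable (by fun_prop) _ _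
  · exact Continuous.aestronglyMeasurable (by fun_prop)
  · refine .of_forall fun y hy z hz => ?_
    rw [norm_mul]
    refine mul_le_mul_of_nonneg_right (hC _ ?_) (norm_nonneg _)
    rw [Real.closedBall_eq_Icc] at hz
    have hya : |y| ≤ |a| := by
      rcases Set.mem_uIoc.1 hy with h | h
      · exact (abs_le.2 ⟨h.1.le, h.2⟩).trans (le_abs_self a)
      · exact (abs_le.2 ⟨by linarith [h.1], by linarith [h.2]⟩ : |y| ≤ -a).trans (neg_le_abs a)
    have := abs_le.1 hya
    constructor <;> linarith [hz.1, hz.2]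
  · exact Continuous.intervalIntegrable (by fun_prop) _ _
  · refine .of_forall fun y _ z _ => ?_
    have h1 : HasDerivAt p (deriv p (z - y)) (z - y) :=
      (hp.differentiable one_ne_zero _).hasDerivAt
    exact (h1.comp_sub_const z y).mul_const (g y)

lemma integral_deriv_conv {p : ℝ → ℝ} (hp : ContDiff ℝ 1 p) (h : MidConcaveProfile a g v)
    (x : ℝ) : ∫ y in -a..a, deriv p (x - y) * g y = -convSlope p a g v x := by
  have hp' : Continuous (deriv p) := hp.continuous_deriv le_rfl
  have hv := h.continuous_slope
  have key := intervalIntegral.integral_mul_deriv_eq_deriv_mul (a := -a) (b := a)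
    (u := g) (u' := fun y => -v y) (v := fun y => p (x - y)) (v' := fun y => -deriv p (x - y))
    (fun y _ => h.hasDerivAt y)
    (fun y _ => ((hp.differentiable one_ne_zero _).hasDerivAt.comp_const_sub x y))
    (Continuous.intervalIntegrable (by fun_prop) _ _)
    (Continuous.intervalIntegrable (by fun_prop) _ _)
  simp only [mul_neg, neg_mul, intervalIntegral.integral_neg, sub_neg_eq_add, h.map_neg] at key
  simp only [convSlope, mul_comm (p _) (v _), mul_comm (deriv p _) (g _)]
  linarith

lemma integral_mul_odd {p : ℝ → ℝ} (hp : Continuous p) (hv : Continuous v)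
    (hodd : ∀ y, v (-y) = -v y) (x : ℝ) :
    ∫ y in -a..a, p (x - y) * v y = ∫ y in 0..a, (p (x - y) - p (x + y)) * v y := by
  rw [← intervalIntegral.integral_add_adjacent_intervals (b := 0)
    (Continuous.intervalIntegrable (by fun_prop) _ _)
    (Continuous.intervalIntegrable (by fun_prop) _ _)]
  have h1 := intervalIntegral.integral_comp_neg (a := 0) (b := a) fun y => p (x - y) * v y
  simp only [neg_zero, sub_neg_eq_add, hodd] at h1
  rw [← h1, ← intervalIntegral.integral_add (Continuous.intervalIntegrable (by fun_prop) _ _)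
    (Continuous.intervalIntegrable (by fun_prop) _ _)]
  congr 1 with y
  ring

lemma integral_nonneg_of_add_reflect {f : ℝ → ℝ} {m : ℝ} (hf : Continuous f) (hm : 0 ≤ m)
    (h : ∀ y, 0 ≤ y → y ≤ m / 2 → 0 ≤ f y + f (m - y)) : 0 ≤ ∫ y in 0..m, f y := by
  have h1 := intervalIntegral.integral_comp_sub_left (a := 0) (b := m) f m
  rw [sub_self, sub_zero] at h1
  have h2 : 0 ≤ ∫ y in 0..m, (f y + f (m - y)) := by
    refine intervalIntegral.integral_nonneg hm fun y hy => ?_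
    rcases le_total y (m / 2) with hym | hym
    · exact h y hy.1 hym
    · have := h (m - y) (by linarith [hy.2]) (by linarith)
      rw [sub_sub_cancel] at this
      linarith
  rw [intervalIntegral.integral_add (Continuous.intervalIntegrable (by fun_prop) _ _)
    (Continuous.intervalIntegrable (by fun_prop) _ _), h1] at h2
  linarith

lemma convSlope_le {p : ℝ → ℝ} (hpc : Continuous p) (hp : ∀ y z, |y| ≤ |z| → p z ≤ p y)
    (h : MidConcaveProfile a g v) {x z : ℝ} (hx : 0 ≤ x) (hxz : x ≤ z) (hxa : x + z ≤ a) :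
    convSlope p a g v x ≤ convSlope p a g v z := by
  have hv := h.continuous_slope
  have hple : ∀ y z, y ≤ z → -z ≤ y → p z ≤ p y := fun y z h1 h2 =>
    hp y z ((abs_le.2 ⟨h2, h1⟩).trans (le_abs_self z))
  have heven := even_of_le_of_abs_le hp
  set c : ℝ → ℝ := fun y => (p (z - y) - p (z + y)) - (p (x - y) - p (x + y)) with hc
  have hc_far : ∀ y, z ≤ y → 0 ≤ c y := fun y hy => by
    have h1 := hple (y - z) (y - x) (by linarith) (by linarith)
    have h2 := hple (x + y) (z + y) (by linarith) (by linarith)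
    rw [← heven, neg_sub] at h1
    rw [← heven (y - z), neg_sub] at h1
    simp only [hc]
    linarith
  have hcc : Continuous c := by fun_prop
  have hnear : 0 ≤ ∫ y in 0..(x + z), c y * v y := by
    refine integral_nonneg_of_add_reflect (by fun_prop) (by linarith) fun y hy hym => ?_
    have hvle := h.slope_le y (x + z - y) hy (by linarith) (by linarith)
    have hv0 := h.slope_nonneg hy (by linarith)
    have e1 : p (z - (x + z - y)) = p (x - y) := by
      rw [← heven]; congr 1; ring
    have e2 : p (x - (x + z - y)) = p (z - y) := by
      rw [← heven]; congr 1; ring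
    have hc' : 0 ≤ c (x + z - y) := by
      have h1 : p (z - y) ≤ p (x - y) := hple _ _ (by linarith) (by linarith)
      have h2 := hple (x + (x + z - y)) (z + (x + z - y)) (by linarith) (by linarith)
      simp only [hc, e1, e2]
      linarith
    have hsum : 0 ≤ c y + c (x + z - y) := by
      simp only [hc, e1, e2]
      rcases le_total x y with hxy | hxy
      · have h1 := hple (x + y) (z + (x + z - y)) (by linarith) (by linarith)
        have h2 := hple (x + (x + z - y)) (z + y) (by linarith) (by linarith)
        linarith
      · have h1 := hple (x + y) (z + y) (by linarith) (by linarith)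
        have h2 := hple (x + (x + z - y)) (z + (x + z - y)) (by linarith) (by linarith)
        linarith
    nlinarith [mul_nonneg hc' (sub_nonneg.2 hvle), mul_nonneg hsum hv0]
  have hfar : 0 ≤ ∫ y in (x + z)..a, c y * v y :=
    intervalIntegral.integral_nonneg hxa fun y hy =>
      mul_nonneg (hc_far y (by linarith [hy.1])) (h.slope_nonneg (by linarith [hy.1]) hy.2)
  have hend : 0 ≤ g a * c a := mul_nonneg h.nonneg_end (hc_far a (by linarith))
  have htot := add_nonneg hnear hfar
  rw [intervalIntegral.integral_add_adjacent_intervals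
    (Continuous.intervalIntegrable (by fun_prop) _ _)
    (Continuous.intervalIntegrable (by fun_prop) _ _)] at htot
  have hsplit : ∫ y in 0..a, c y * v y = (∫ y in 0..a, (p (z - y) - p (z + y)) * v y) -
      ∫ y in 0..a, (p (x - y) - p (x + y)) * v y := by
    rw [← intervalIntegral.integral_sub (Continuous.intervalIntegrable (by fun_prop) _ _)
      (Continuous.intervalIntegrable (by fun_prop) _ _)]
    simp only [hc, sub_mul]
  rw [hsplit] at htot
  simp only [hc] at hend
  rw [convSlope, convSlope, integral_mul_odd hpc hv h.slope_neg,
    integral_mul_odd hpc hv h.slope_neg]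
  linarith

lemma convolution {p : ℝ → ℝ} (ha : 0 < a) (hpd : ContDiff ℝ 1 p) (hp : ∀ y z, |y| ≤ |z| → p z ≤ p y)
    (hp0 : ∀ y, 0 ≤ p y) (h : MidConcaveProfile a g v) :
    MidConcaveProfile a (fun x => ∫ y in -a..a, p (x - y) * g y) (convSlope p a g v) where
  hasDerivAt x := by
    rw [← integral_deriv_conv hpd h]
    exact hasDerivAt_conv hpd h.continuous x
  continuous_slope := by
    have hpc := hpd.continuous
    have hv := h.continuous_slope
    refine Continuous.add ?_ (by fun_prop)
    exact intervalIntegral.continuous_parametric_intervalIntegral_of_continuous' (by fun_prop) _ _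
  slope_neg x := by
    have heven := even_of_le_of_abs_le hp
    have h1 := intervalIntegral.integral_comp_neg (a := -a) (b := a) fun y => p (-x - y) * v y
    rw [neg_neg] at h1
    have h2 : ∀ y, p (-x - -y) * v (-y) = -(p (x - y) * v y) := fun y => by
      rw [h.slope_neg, ← heven, show -(-x - -y) = x - y by ring]
      ring
    simp only [h2, intervalIntegral.integral_neg] at h1
    rw [convSlope, convSlope, ← h1, ← heven (-x - a), ← heven (-x + a),
      show -(-x - a) = x + a by ring, show -(-x + a) = x - a by ring]
    ring
  map_neg x := by
    have heven := even_of_le_of_abs_le hp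
    have h1 := intervalIntegral.integral_comp_neg (a := -a) (b := a) fun y => p (-x - y) * g y
    rw [neg_neg] at h1
    rw [← h1]
    congr 1 with y
    rw [h.map_neg, ← heven, show -(-x - -y) = x - y by ring]
  nonneg_end := by
    refine intervalIntegral.integral_nonneg (by linarith) fun y hy => mul_nonneg (hp0 _) ?_
    rcases le_total 0 y with h0 | h0
    · exact h.nonneg h0 hy.2
    · rw [← h.map_neg]
      exact h.nonneg (by linarith) (by linarith [hy.1])
  slope_le _ _ hy hyz hyza := convSlope_le hpd.continuous hp h hy hyz hyza

end MidConcaveProfile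

/-- `brownianFDD` in terms of the time increments `s`. -/
noncomputable def incrementFDD (n : ℕ) (a : ℝ) (s : Fin n → ℝ) (x : ℝ) : ℝ :=
  ∫ y in Set.Icc (fun _ : Fin n => -a) (fun _ : Fin n => a),
    ∏ i : Fin n, gaussDensity (s i)
      ((Fin.cons x y : Fin (n + 1) → ℝ) i.castSucc - (Fin.cons x y : Fin (n + 1) → ℝ) i.succ)

lemma incrementFDD_zero (a : ℝ) (s : Fin 0 → ℝ) (x : ℝ) : incrementFDD 0 a s x = 1 := by
  have : Set.Icc (fun _ : Fin 0 => -a) (fun _ : Fin 0 => a) = Set.univ :=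
    Set.eq_univ_of_forall fun y => ⟨fun i => i.elim0, fun i => i.elim0⟩
  simp [incrementFDD, this, measureReal_def, volume_pi]

lemma incrementFDD_succ (n : ℕ) {a : ℝ} (ha : 0 < a) (s : Fin (n + 1) → ℝ) (x : ℝ) :
    incrementFDD (n + 1) a s x =
      ∫ y in -a..a, gaussDensity (s 0) (x - y) * incrementFDD n a (fun i => s i.succ) y := by
  set f : ℝ × (Fin n → ℝ) → ℝ := fun q => gaussDensity (s 0) (x - q.1) *
    ∏ i : Fin n, gaussDensity (s i.succ)
      ((Fin.cons q.1 q.2 : Fin (n + 1) → ℝ) i.castSucc - q.2 i) with hf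
  have hcont : Continuous f := by
    have hg : ∀ r, Continuous (gaussDensity r) := fun r => (contDiff_gaussDensity r).continuous
    refine ((hg _).comp (by fun_prop)).mul (continuous_finsetProd _ fun i _ => (hg _).comp ?_)
    refine Continuous.sub ?_ (by fun_prop)
    rcases i.castSucc.eq_zero_or_eq_succ with h | ⟨j, h⟩ <;>
      simp only [h, Fin.cons_zero, Fin.cons_succ] <;> fun_prop
  have hpre : Set.Icc (fun _ : Fin (n + 1) => -a) (fun _ => a) =
      MeasurableEquiv.piFinSuccAbove (fun _ => ℝ) 0 ⁻¹'
        (Set.Icc (-a) a ×ˢ Set.Icc (fun _ : Fin n => -a) (fun _ => a)) := by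
    ext y
    simp [Set.mem_Icc, Pi.le_def, Fin.forall_fin_succ]
    tauto
  have hint : IntegrableOn f (Set.Icc (-a) a ×ˢ Set.Icc (fun _ : Fin n => -a) (fun _ => a))
      (volume.prod volume) :=
    hcont.continuousOn.integrableOn_compact (isCompact_Icc.prod isCompact_Icc)
  have hfub := setIntegral_prod f hint
  have hmp := (volume_preserving_piFinSuccAbove (fun _ : Fin (n + 1) => ℝ) 0
    ).setIntegral_preimage_emb (MeasurableEquiv.measurableEmbedding _) f
      (Set.Icc (-a) a ×ˢ Set.Icc (fun _ : Fin n => -a) (fun _ => a))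
  rw [intervalIntegral.integral_of_le (by linarith), ← integral_Icc_eq_integral_Ioc]
  rw [incrementFDD, hpre]
  refine Eq.trans ?_ (hmp.trans (hfub.trans ?_))
  · congr 1 with y
    rw [Fin.prod_univ_succ]
    simp only [hf, MeasurableEquiv.piFinSuccAbove]
    congr 1
    refine Finset.prod_congr rfl fun i _ => ?_
    congr 2
    rw [← Fin.succ_castSucc, Fin.cons_succ]
    refine congrFun (?_ : y = _) _
    exact (Fin.cons_self_tail y).symm
  · congr 1 with y
    rw [incrementFDD, ← integral_const_mul]
    simp [hf]

lemma exists_midConcaveProfile_incrementFDD {a : ℝ} (ha : 0 < a) :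
    ∀ (n : ℕ) (s : Fin n → ℝ), (∀ i, 0 < s i) →
      ∃ v, MidConcaveProfile a (incrementFDD n a s) v
  | 0, s, _ => ⟨fun _ => 0, by
      have : incrementFDD 0 a s = fun _ => 1 := funext (incrementFDD_zero a s)
      rw [this]
      exact ⟨fun x => by simpa using hasDerivAt_const x (1 : ℝ), continuous_const,
        fun _ => by simp, fun _ => rfl, zero_le_one, fun _ _ _ _ _ => le_rfl⟩⟩
  | n + 1, s, hs => by
      obtain ⟨v, hv⟩ := exists_midConcaveProfile_incrementFDD ha n (fun i => s i.succ)
        fun i => hs i.succ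
      rw [funext (incrementFDD_succ n ha s)]
      refine ⟨_, hv.convolution ha (contDiff_gaussDensity (s 0))
        (fun _ _ => gaussDensity_le_of_abs_le (hs 0)) fun y => ?_⟩
      unfold gaussDensity
      positivity

/-- `F` is concave on `(-a/2, a/2)`, with `F' ≥ 0` on `(-a, 0)` and `F' ≤ 0` on `(0, a)`. -/
theorem brownian_fdd_mid_concave (n : ℕ) (hn : 0 < n) (a : ℝ) (ha : 0 < a)
    (t : Fin n → ℝ) (ht : ∀ i, 0 < t i) (htm : StrictMono t) :
    ConcaveOn ℝ (Set.Ioo (-(a / 2)) (a / 2)) (brownianFDD n a t) ∧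
    (∀ x ∈ Set.Ioo (-a) (0 : ℝ), 0 ≤ deriv (brownianFDD n a t) x) ∧
    (∀ x ∈ Set.Ioo (0 : ℝ) a, deriv (brownianFDD n a t) x ≤ 0) := by
  have hcons : StrictMono (Fin.cons 0 t : Fin (n + 1) → ℝ) := by
    intro i j hij
    obtain ⟨k, rfl⟩ := Fin.exists_succ_eq.2 (Fin.ne_zero_of_lt hij)
    rcases i.eq_zero_or_eq_succ with rfl | ⟨l, rfl⟩
    · simpa using ht k
    · simpa using htm (Fin.succ_lt_succ_iff.1 hij)
  obtain ⟨v, hv⟩ := exists_midConcaveProfile_incrementFDD ha n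
    (fun i => (Fin.cons 0 t : Fin (n + 1) → ℝ) i.succ -
      (Fin.cons 0 t : Fin (n + 1) → ℝ) i.castSucc)
    fun i => sub_pos.2 (hcons i.castSucc_lt_succ)
  change MidConcaveProfile a (brownianFDD n a t) v at hv
  refine ⟨hv.concaveOn, fun x hx => ?_, fun x hx => ?_⟩
  · have := hv.slope_nonneg (x := -x) (by linarith [hx.2]) (by linarith [hx.1])
    rwa [hv.slope_neg, ← (hv.hasDerivAt x).deriv] at this
  · rw [(hv.hasDerivAt x).deriv]
    exact neg_nonpos.2 (hv.slope_nonneg hx.1.le hx.2.le)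
end
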